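/- Suppose τ ≥ 0 and g(x,A') − g(x,A) ≤ τ·ζ(A,A') for all x ∈ ℝ^m and all A,A' ∈ 𝒜 with ζ(A,A') > 0 (property (P6)). Then for every x ∈ ℝ^m, every y ≥ τ and every A ∈ 𝒜 one has g(x,y,A) = max{ g(x,A') : A' ∈ 𝒜, ζ(A,A') = 0 } = g(x,τ,A); consequently h_p(x,y) = h_p(x,τ) + r·(y − τ) ≥ h_p(x,τ) for all y ≥ τ, and hence the infimum of y ↦ h_p(x,y) over [0,∞) equals its infimum over [0,τ]. -/

import Mathlib

open Finset

/-- Under property (P6) with parameter `τ ≥ 0`, for every `x`, every `y ≥ τ`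
and every scenario `A`, `g(x,y,A)` equals the maximum of `g(x,A')` over scenarios `A'`
with `ζ(A,A') = 0`, and equals `g(x,τ,A)`; consequently `h_p(x,y) = h_p(x,τ) + r(y-τ) ≥
h_p(x,τ)`, and the infimum of `y ↦ h_p(x,y)` over `[0,∞)` equals its infimum over `[0,τ]`. -/
theorem stmt0 {m : ℕ} {𝒜 : Type*} [Fintype 𝒜] [Nonempty 𝒜]
    (ζ : 𝒜 → 𝒜 → ℝ) (hζnn : ∀ A A', 0 ≤ ζ A A') (hζ0 : ∀ A, ζ A A = 0)
    (r : ℝ) (hr : 0 < r)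
    (p : 𝒜 → ℝ) (hp : ∀ A, 0 ≤ p A) (hp1 : ∑ A, p A = 1)
    (c : Fin m → ℝ) (hc : ∀ i, 0 ≤ c i)
    (g : (Fin m → ℝ) → 𝒜 → ℝ)
    (τ : ℝ) (hτ : 0 ≤ τ)
    (hP6 : ∀ (x : Fin m → ℝ) (A A' : 𝒜), 0 < ζ A A' → g x A' - g x A ≤ τ * ζ A A')
    (gxy : (Fin m → ℝ) → ℝ → 𝒜 → ℝ)
    (hgxy : ∀ x y A, IsGreatest {v | ∃ A' : 𝒜, v = g x A' - y * ζ A A'} (gxy x y A))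
    (h : (Fin m → ℝ) → ℝ → ℝ)
    (hh : ∀ x y, h x y = (∑ i, c i * x i) + r * y + ∑ A, p A * gxy x y A) :
    (∀ (x : Fin m → ℝ) (y : ℝ), τ ≤ y → ∀ A : 𝒜,
        IsGreatest {v | ∃ A' : 𝒜, ζ A A' = 0 ∧ v = g x A'} (gxy x y A) ∧
        gxy x y A = gxy x τ A) ∧
    (∀ (x : Fin m → ℝ) (y : ℝ), τ ≤ y →
        h x y = h x τ + r * (y - τ) ∧ h x τ ≤ h x y) ∧
    (∀ x : Fin m → ℝ,
        sInf ((fun y => h x y) '' Set.Ici (0 : ℝ)) =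
        sInf ((fun y => h x y) '' Set.Icc (0 : ℝ) τ)) := by
  have hge : ∀ x y A, g x A ≤ gxy x y A := fun x y A =>
    (hgxy x y A).2 ⟨A, by rw [hζ0]; ring⟩
  have key : ∀ (x : Fin m → ℝ) (y : ℝ), τ ≤ y → ∀ A : 𝒜,
      IsGreatest {v | ∃ A' : 𝒜, ζ A A' = 0 ∧ v = g x A'} (gxy x y A) := by
    intro x y hy A
    constructor
    · obtain ⟨A', hA'⟩ := (hgxy x y A).1
      rcases (hζnn A A').eq_or_lt with h0 | h0
      · exact ⟨A', h0.symm, by rw [hA', ← h0]; ring⟩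
      · refine ⟨A, hζ0 A, le_antisymm ?_ (hge x y A)⟩
        have h1 := hP6 x A A' h0
        have h2 := mul_le_mul_of_nonneg_right hy h0.le
        linarith
    · rintro v ⟨A', h0, rfl⟩
      exact (hgxy x y A).2 ⟨A', by rw [h0]; ring⟩
  have keq : ∀ (x : Fin m → ℝ) (y : ℝ), τ ≤ y → ∀ A : 𝒜, gxy x y A = gxy x τ A :=
    fun x y hy A => (key x y hy A).unique (key x τ le_rfl A)
  have hhy : ∀ (x : Fin m → ℝ) (y : ℝ), τ ≤ y →
      h x y = h x τ + r * (y - τ) ∧ h x τ ≤ h x y := by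
    intro x y hy
    have e : h x y = h x τ + r * (y - τ) := by
      rw [hh, hh, funext (keq x y hy)]
      ring
    have := mul_nonneg hr.le (sub_nonneg.2 hy)
    exact ⟨e, by linarith⟩
  refine ⟨fun x y hy A => ⟨key x y hy A, keq x y hy A⟩, hhy, fun x => ?_⟩
  have hbdd : BddBelow ((fun y => h x y) '' Set.Ici (0 : ℝ)) := by
    refine ⟨(∑ i, c i * x i) + ∑ A, p A * g x A, ?_⟩
    rintro _ ⟨y, hy, rfl⟩
    have h1 : ∑ A, p A * g x A ≤ ∑ A, p A * gxy x y A :=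
      Finset.sum_le_sum fun A _ => mul_le_mul_of_nonneg_left (hge x y A) (hp A)
    have h2 := mul_nonneg hr.le (Set.mem_Ici.1 hy)
    simp only [hh]
    linarith
  have hsub : (fun y => h x y) '' Set.Icc (0 : ℝ) τ ⊆ (fun y => h x y) '' Set.Ici (0 : ℝ) :=
    Set.image_mono Set.Icc_subset_Ici_self
  have hmem : h x τ ∈ (fun y => h x y) '' Set.Icc (0 : ℝ) τ := ⟨τ, ⟨hτ, le_rfl⟩, rfl⟩
  apply le_antisymm
  · exact csInf_le_csInf hbdd ⟨_, hmem⟩ hsub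
  · refine le_csInf ⟨_, hsub hmem⟩ ?_
    rintro _ ⟨y, hy, rfl⟩
    rcases le_total y τ with hyτ | hyτ
    · exact csInf_le (hbdd.mono hsub) ⟨y, ⟨hy, hyτ⟩, rfl⟩
    · exact (csInf_le (hbdd.mono hsub) hmem).trans (hhy x y hyτ).2
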